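/- arXiv:2006.12180 — 2 statements merged into one kernel-verified Lean document; each statement's English description precedes it below -/
import Mathlib

section
/- Let d ≥ 1 be an integer, μ ∈ ℝ^d, Σ a symmetric positive definite real d×d matrix, and θ ∈ (0,1). Then Mardia's kurtosis of the MTIN distribution equals k(θ)·d·(d+2): with v(θ) = −log(1−θ)/θ and k(θ) = θ²/((1−θ)·log²(1−θ)), one has ∫_{ℝ^d} [ (x−μ)ᵀ (v(θ)Σ)⁻¹ (x−μ) ]² · f_TIN(x; μ, Σ, θ) dx = k(θ) · d · (d+2). -/
open MeasureTheory Real Filter Set Matrix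

/-- Upper incomplete gamma function `Γ(s, x) = ∫ₓ^∞ t^(s-1) e^(-t) dt`. -/
noncomputable def uGamma (s x : ℝ) : ℝ := ∫ t in Set.Ioi x, t ^ (s - 1) * Real.exp (-t)

/-- Squared Mahalanobis distance `δ(x) = (x-μ)ᵀ Σ⁻¹ (x-μ)`. -/
noncomputable def mahal {d : ℕ} (μ : Fin d → ℝ) (S : Matrix (Fin d) (Fin d) ℝ)
    (x : Fin d → ℝ) : ℝ :=
  (x - μ) ⬝ᵥ (S⁻¹ *ᵥ (x - μ))

/-- The multivariate tail-inflated normal (MTIN) density. -/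
noncomputable def mtin (d : ℕ) (μ : Fin d → ℝ) (S : Matrix (Fin d) (Fin d) ℝ) (θ : ℝ)
    (x : Fin d → ℝ) : ℝ :=
  2 * Real.pi ^ (-(d : ℝ) / 2) * S.det ^ (-(1 : ℝ) / 2) /
      (θ * mahal μ S x ^ ((d : ℝ) / 2 + 1)) *
    (uGamma ((d : ℝ) / 2 + 1) ((1 - θ) * mahal μ S x / 2) -
      uGamma ((d : ℝ) / 2 + 1) (mahal μ S x / 2))

open scoped MatrixOrder Matrix.Norms.L2Operator in
theorem Matrix.PosDef.exists_transpose_mul_self {n : Type*} [Fintype n] [DecidableEq n]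
    {A : Matrix n n ℝ} (hA : A.PosDef) : ∃ B : Matrix n n ℝ, A = Bᵀ * B := by
  obtain ⟨B, hB⟩ := CStarAlgebra.nonneg_iff_eq_star_mul_self.mp hA.posSemidef.nonneg
  exact ⟨B, by simpa [Matrix.star_eq_conjTranspose] using hB⟩

/-- Change of variables: a function of the Mahalanobis distance integrates like a radial one. -/
theorem integral_comp_mahal {d : ℕ} (μ : Fin d → ℝ) {S : Matrix (Fin d) (Fin d) ℝ}
    (hS : S.PosDef) (f : ℝ → ℝ) :
    ∫ x, f (mahal μ S x) =
      S.det ^ ((1 : ℝ) / 2) * ∫ y : EuclideanSpace ℝ (Fin d), f (‖y‖ ^ 2) := by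
  obtain ⟨B, hB⟩ := hS.inv.exists_transpose_mul_self
  have hdet : B.det * B.det = S.det⁻¹ := by
    have h := congrArg Matrix.det hB
    rwa [Matrix.det_mul, Matrix.det_transpose, Matrix.det_nonsing_inv, Ring.inverse_eq_inv',
      eq_comm] at h
  have hB0 : B.det ≠ 0 := by
    intro h
    rw [h, mul_zero, eq_comm, inv_eq_zero] at hdet
    exact hS.det_pos.ne' hdet
  have habs : |B.det⁻¹| = S.det ^ ((1 : ℝ) / 2) := by
    rw [← Real.sqrt_eq_rpow, ← Real.sqrt_sq_eq_abs, inv_pow, sq, hdet, inv_inv]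
  have hmahal (x : Fin d → ℝ) :
      mahal μ S x = ‖WithLp.toLp 2 (Matrix.toLin' B (x - μ))‖ ^ 2 := by
    rw [mahal, hB, ← Matrix.mulVec_mulVec, Matrix.dotProduct_mulVec, Matrix.vecMul_transpose,
      EuclideanSpace.norm_sq_eq]
    simp [dotProduct, sq]
  have hemb : MeasurableEmbedding (Matrix.toLin' B) := by
    let e := LinearEquiv.ofIsUnitDet (f := Matrix.toLin' B) (v := Pi.basisFun ℝ (Fin d))
      (v' := Pi.basisFun ℝ (Fin d)) (by simpa [LinearMap.toMatrix_eq_toMatrix'] using hB0)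
    exact e.toContinuousLinearEquiv.toHomeomorph.measurableEmbedding
  simp_rw [hmahal]
  rw [integral_sub_right_eq_self (fun x => f (‖WithLp.toLp 2 (Matrix.toLin' B x)‖ ^ 2)) μ,
    ← hemb.integral_map (fun x => f (‖WithLp.toLp 2 x‖ ^ 2)),
    Real.map_matrix_volume_pi_eq_smul_volume_pi hB0, integral_smul_measure,
    ENNReal.toReal_ofReal (abs_nonneg _), habs, smul_eq_mul,
    (PiLp.volume_preserving_toLp (Fin d)).integral_comp
      (MeasurableEquiv.toLp 2 (Fin d → ℝ)).measurableEmbedding (fun y => f (‖y‖ ^ 2))]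

/-- The fourth radial moment of an isotropic Gaussian weight. -/
theorem integral_norm_pow_four_mul_exp {d : ℕ} (hd : 1 ≤ d) {b : ℝ} (hb : 0 < b) :
    ∫ y : EuclideanSpace ℝ (Fin d), (‖y‖ ^ 2) ^ 2 * rexp (-b * ‖y‖ ^ 2) =
      π ^ ((d : ℝ) / 2) * (d * (d + 2) / 4) * b ^ (-((d : ℝ) / 2 + 2)) := by
  have : Nonempty (Fin d) := ⟨⟨0, hd⟩⟩
  have : Nontrivial (EuclideanSpace ℝ (Fin d)) :=
    Module.nontrivial_of_finrank_pos (R := ℝ) (by rw [finrank_euclideanSpace_fin]; exact hd)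
  have hd0 : (0 : ℝ) ≤ d := d.cast_nonneg
  have hG : 0 < Real.Gamma ((d : ℝ) / 2 + 1) := Real.Gamma_pos_of_pos (by positivity)
  have hrad : ∫ r in Ioi (0 : ℝ), r ^ (d - 1) • ((r ^ 2) ^ 2 * rexp (-b * r ^ 2)) =
      b ^ (-((d : ℝ) / 2 + 2)) * (1 / 2) * (((d : ℝ) / 2 + 1) * Real.Gamma ((d : ℝ) / 2 + 1)) := by
    rw [← Real.Gamma_add_one (by positivity)]
    convert integral_rpow_mul_exp_neg_mul_rpow (p := 2) (q := (d : ℝ) + 3) two_pos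
      (by linarith) hb using 1
    · refine setIntegral_congr_fun measurableSet_Ioi fun r _ => ?_
      have h : r ^ ((d : ℝ) + 3) = r ^ (d - 1) * (r ^ 2) ^ 2 := by
        rw [← pow_mul, ← pow_add, ← Real.rpow_natCast]
        congr 1
        push_cast [Nat.cast_sub hd]
        ring
      simp only [smul_eq_mul, h, Real.rpow_two, mul_assoc]
    · congr 2 <;> ring_nf
  have hball : volume.real (Metric.ball (0 : EuclideanSpace ℝ (Fin d)) 1) =
      π ^ ((d : ℝ) / 2) / Real.Gamma ((d : ℝ) / 2 + 1) := by
    have hπ : √π ^ d = π ^ ((d : ℝ) / 2) := by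
      rw [Real.sqrt_eq_rpow, ← Real.rpow_mul_natCast pi_pos.le]
      ring_nf
    rw [measureReal_def, EuclideanSpace.volume_ball, Fintype.card_fin, hπ]
    simp [ENNReal.toReal_ofReal, div_nonneg, Real.rpow_nonneg pi_pos.le, hG.le]
  rw [integral_fun_norm_addHaar volume (fun r => (r ^ 2) ^ 2 * rexp (-b * r ^ 2)),
    finrank_euclideanSpace_fin, hrad, hball, nsmul_eq_mul, smul_eq_mul]
  field_simp
  ring

theorem uGamma_sub_uGamma {s a u : ℝ} (hs : 0 < s) (ha : 0 < a) (hu : 0 < u) :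
    uGamma s (a * u) - uGamma s u = u ^ s * ∫ w in a..1, w ^ (s - 1) * rexp (-u * w) := by
  have h_integrable : IntegrableOn (fun t : ℝ => t ^ (s - 1) * rexp (-t)) (Ioi 0) := by
    simpa only [mul_comm] using Real.GammaIntegral_convergent hs
  rw [uGamma, uGamma, intervalIntegral.integral_Ioi_sub_Ioi'
    (h_integrable.mono_set (Ioi_subset_Ioi (by positivity))) (h_integrable.mono_set (Ioi_subset_Ioi hu.le))]
  have h := intervalIntegral.integral_comp_mul_right (a := a) (b := 1)
    (fun t : ℝ => t ^ (s - 1) * rexp (-t)) hu.ne'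
  rw [one_mul, smul_eq_mul, eq_inv_mul_iff_mul_eq₀ hu.ne'] at h
  rw [← h, ← intervalIntegral.integral_const_mul, ← intervalIntegral.integral_const_mul]
  refine intervalIntegral.integral_congr fun w hw => ?_
  have hw0 : 0 < w := lt_of_lt_of_le (lt_min ha one_pos) hw.1
  have hpow : u ^ s = u * u ^ (s - 1) := by
    rw [Real.rpow_sub_one hu.ne']
    field_simp
  simp only [Real.mul_rpow hw0.le hu.le, hpow]
  ring_nf

/-- Integrating the fourth radial moment against the mixing weight on `[a, 1]`. -/
theorem integral_norm_pow_four_mul_mixture {d : ℕ} (hd : 1 ≤ d) {a : ℝ} (ha : 0 < a)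
    (ha1 : a ≤ 1) :
    ∫ y : EuclideanSpace ℝ (Fin d), (‖y‖ ^ 2) ^ 2 *
        ∫ w in a..1, w ^ ((d : ℝ) / 2) * rexp (-(‖y‖ ^ 2 / 2) * w) =
      π ^ ((d : ℝ) / 2) * (d * (d + 2) / 4) * 2 ^ ((d : ℝ) / 2 + 2) * (1 / a - 1) := by
  have hd0 : (0 : ℝ) < d := by exact_mod_cast hd
  have hgauss : Integrable fun y : EuclideanSpace ℝ (Fin d) =>
      (‖y‖ ^ 2) ^ 2 * rexp (-(a / 2) * ‖y‖ ^ 2) := by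
    refine .of_integral_ne_zero ?_
    rw [integral_norm_pow_four_mul_exp hd (half_pos ha)]
    positivity
  have h_integrable : Integrable (Function.uncurry fun (w : ℝ) (y : EuclideanSpace ℝ (Fin d)) =>
      (‖y‖ ^ 2) ^ 2 * (w ^ ((d : ℝ) / 2) * rexp (-(‖y‖ ^ 2 / 2) * w)))
      ((volume.restrict (uIoc a 1)).prod volume) := by
    have hone : Integrable (fun _ : ℝ => (1 : ℝ)) (volume.restrict (uIoc a 1)) :=
      integrableOn_const (by simp [uIoc])
    refine (hone.mul_prod hgauss).mono' (by
      refine Continuous.aestronglyMeasurable ?_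
      have := Real.continuous_rpow_const (q := (d : ℝ) / 2) (by positivity)
      unfold Function.uncurry
      fun_prop) ?_
    have hmem : ∀ᵐ z ∂((volume.restrict (uIoc a 1)).prod
        (volume : Measure (EuclideanSpace ℝ (Fin d)))), z.1 ∈ uIoc a 1 :=
      Measure.quasiMeasurePreserving_fst.ae (ae_restrict_mem measurableSet_uIoc)
    filter_upwards [hmem] with z hz
    rw [uIoc_of_le ha1] at hz
    have hz0 : 0 < z.1 := ha.trans hz.1
    simp only [Function.uncurry, one_mul]
    rw [Real.norm_of_nonneg (by positivity)]
    gcongr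
    calc z.1 ^ ((d : ℝ) / 2) * rexp (-(‖z.2‖ ^ 2 / 2) * z.1)
        ≤ 1 * rexp (-(‖z.2‖ ^ 2 / 2) * z.1) := by
          gcongr
          exact Real.rpow_le_one hz0.le hz.2 (by positivity)
      _ ≤ rexp (-(a / 2) * ‖z.2‖ ^ 2) := by
          rw [one_mul, Real.exp_le_exp]
          nlinarith [mul_le_mul_of_nonneg_left hz.1.le (sq_nonneg ‖z.2‖)]
  simp_rw [← intervalIntegral.integral_const_mul]
  rw [← intervalIntegral_integral_swap h_integrable]
  have hinner : ∀ w ∈ uIcc a 1, ∫ y : EuclideanSpace ℝ (Fin d),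
      (‖y‖ ^ 2) ^ 2 * (w ^ ((d : ℝ) / 2) * rexp (-(‖y‖ ^ 2 / 2) * w)) =
      π ^ ((d : ℝ) / 2) * (d * (d + 2) / 4) * 2 ^ ((d : ℝ) / 2 + 2) * w ^ (-2 : ℝ) := by
    intro w hw
    rw [uIcc_of_le ha1] at hw
    have hw0 : 0 < w := ha.trans_le hw.1
    have hpow : w ^ ((d : ℝ) / 2) * (w / 2) ^ (-((d : ℝ) / 2 + 2)) =
        2 ^ ((d : ℝ) / 2 + 2) * w ^ (-2 : ℝ) := by
      rw [Real.div_rpow hw0.le two_pos.le, Real.rpow_neg two_pos.le, div_inv_eq_mul, ← mul_assoc,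
        ← Real.rpow_add hw0, mul_comm]
      ring_nf
    calc _ = w ^ ((d : ℝ) / 2) * ∫ y : EuclideanSpace ℝ (Fin d),
          (‖y‖ ^ 2) ^ 2 * rexp (-(w / 2) * ‖y‖ ^ 2) := by
          rw [← integral_const_mul]
          refine integral_congr_ae (.of_forall fun y => ?_)
          ring_nf
      _ = _ := by
          rw [integral_norm_pow_four_mul_exp hd (half_pos hw0), mul_assoc _ _ (w ^ (-2 : ℝ)),
            ← hpow]
          ring
  rw [intervalIntegral.integral_congr hinner, intervalIntegral.integral_const_mul,
    integral_rpow (.inr ⟨by norm_num, by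
      rw [uIcc_of_le ha1]
      exact fun h => absurd h.1 (not_le.mpr ha)⟩)]
  rw [show (-2 : ℝ) + 1 = -1 by norm_num, Real.rpow_neg_one, Real.rpow_neg_one]
  ring

/-- Mardia's kurtosis of the MTIN distribution equals `k(θ)·d·(d+2)`, where the
covariance matrix of the MTIN is `v(θ)·Σ`, `v(θ) = −log(1−θ)/θ` and
`k(θ) = θ²/((1−θ)·log²(1−θ))`. -/
theorem mtin_kurtosis (d : ℕ) (hd : 1 ≤ d) (μ : Fin d → ℝ)
    (S : Matrix (Fin d) (Fin d) ℝ) (hS : S.PosDef) (θ : ℝ) (hθ : θ ∈ Set.Ioo (0 : ℝ) 1) :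
    ∫ x : Fin d → ℝ,
        ((x - μ) ⬝ᵥ ((((-Real.log (1 - θ) / θ) • S)⁻¹) *ᵥ (x - μ))) ^ 2 * mtin d μ S θ x
      = (θ ^ 2 / ((1 - θ) * Real.log (1 - θ) ^ 2)) * (d : ℝ) * ((d : ℝ) + 2) := by
  obtain ⟨hθ0, hθ1⟩ := hθ
  have ha : 0 < 1 - θ := sub_pos.mpr hθ1
  have hlog : Real.log (1 - θ) ≠ 0 := (Real.log_neg ha (by linarith)).ne
  have hdet := hS.det_pos
  have : Nontrivial (EuclideanSpace ℝ (Fin d)) :=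
    Module.nontrivial_of_finrank_pos (R := ℝ) (by rw [finrank_euclideanSpace_fin]; exact hd)
  set v : ℝ := -Real.log (1 - θ) / θ with hv
  have hv0 : v ≠ 0 := div_ne_zero (neg_ne_zero.mpr hlog) hθ0.ne'
  set C : ℝ := 2 * π ^ (-(d : ℝ) / 2) * S.det ^ (-(1 : ℝ) / 2) with hC
  set s : ℝ := (d : ℝ) / 2 + 1 with hs
  have hs0 : 0 < s := by positivity
  have hscaled (x : Fin d → ℝ) :
      (x - μ) ⬝ᵥ ((v • S)⁻¹ *ᵥ (x - μ)) = v⁻¹ * mahal μ S x := by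
    have : Invertible v := invertibleOfNonzero hv0
    rw [Matrix.inv_smul S v hdet.ne'.isUnit, invOf_eq_inv, Matrix.smul_mulVec, dotProduct_smul,
      smul_eq_mul, mahal]
  have hradial (y : EuclideanSpace ℝ (Fin d)) (hy : y ≠ 0) :
      (v⁻¹ * ‖y‖ ^ 2) ^ 2 * (C / (θ * (‖y‖ ^ 2) ^ s) *
        (uGamma s ((1 - θ) * ‖y‖ ^ 2 / 2) - uGamma s (‖y‖ ^ 2 / 2))) =
      C / (v ^ 2 * θ * 2 ^ s) * ((‖y‖ ^ 2) ^ 2 *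
        ∫ w in (1 - θ)..1, w ^ ((d : ℝ) / 2) * rexp (-(‖y‖ ^ 2 / 2) * w)) := by
    have hy0 : 0 < ‖y‖ ^ 2 := by positivity
    rw [mul_div_assoc (1 - θ), uGamma_sub_uGamma hs0 ha (half_pos hy0), Real.div_rpow hy0.le two_pos.le,
      hs, add_sub_cancel_right, ← hs]
    have : (‖y‖ ^ 2) ^ s ≠ 0 := by positivity
    have : (2 : ℝ) ^ s ≠ 0 := by positivity
    field_simp
  simp_rw [hscaled, mtin]
  rw [integral_comp_mahal μ hS (fun t => (v⁻¹ * t) ^ 2 * (C / (θ * t ^ s) *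
      (uGamma s ((1 - θ) * t / 2) - uGamma s (t / 2)))),
    integral_congr_ae ((Measure.ae_ne volume (0 : EuclideanSpace ℝ (Fin d))).mono hradial),
    integral_const_mul, integral_norm_pow_four_mul_mixture hd ha (by linarith)]
  have hπ : π ^ (-(d : ℝ) / 2) * π ^ ((d : ℝ) / 2) = 1 := by
    rw [← Real.rpow_add pi_pos]
    ring_nf
    simp
  have hS1 : S.det ^ ((1 : ℝ) / 2) * S.det ^ (-(1 : ℝ) / 2) = 1 := by
    rw [← Real.rpow_add hdet]
    norm_num
  have h2 : (2 : ℝ) ^ ((d : ℝ) / 2 + 2) = 2 * 2 ^ s := by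
    rw [hs, ← Real.rpow_one_add' two_pos.le (by positivity)]
    ring_nf
  have h2s : (2 : ℝ) ^ s ≠ 0 := by positivity
  calc _ = (S.det ^ ((1 : ℝ) / 2) * S.det ^ (-(1 : ℝ) / 2)) *
        (π ^ (-(d : ℝ) / 2) * π ^ ((d : ℝ) / 2)) *
        (2 * (d * (d + 2) / 4) * (2 * 2 ^ s) * (1 / (1 - θ) - 1) / (v ^ 2 * θ * 2 ^ s)) := by
        rw [hC, h2]
        ring
    _ = _ := by
        rw [hS1, hπ, hv]
        have := ha.ne'
        field_simp
        ring
end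

section
/- Let d ≥ 1 be an integer and θ ∈ (0,1), and define the weighting function w(δ, θ; d) = 2·[Γ(d/2+2, (1−θ)δ/2) − Γ(d/2+2, δ/2)] / ( δ·[Γ(d/2+1, (1−θ)δ/2) − Γ(d/2+1, δ/2)] ) for δ > 0. Then the limit of w(δ, θ; d) as δ → ∞ equals 1 − θ. -/
open MeasureTheory Real Filter Set

lemma uGamma_sub_uGamma_s16 {s x y : ℝ} (hs : 0 < s) (hx : 0 < x) (hxy : x ≤ y) :
    uGamma s x - uGamma s y = ∫ t in x..y, t ^ (s - 1) * Real.exp (-t) := by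
  have h : ∀ z, 0 < z → IntegrableOn (fun t : ℝ => t ^ (s - 1) * Real.exp (-t)) (Ioi z) :=
    fun z hz => ((Real.GammaIntegral_convergent hs).mono_set (Ioi_subset_Ioi hz.le)).congr_fun
      (fun t _ => mul_comm _ _) measurableSet_Ioi
  rw [uGamma, uGamma, intervalIntegral.integral_Ioi_sub_Ioi (h x hx) hxy,
    intervalIntegral.integral_of_le hxy]

lemma intervalIntegrable_rpow_mul_exp_neg (r : ℝ) {x y : ℝ} (hx : 0 < x) (hxy : x ≤ y) :
    IntervalIntegrable (fun t : ℝ => t ^ r * Real.exp (-t)) volume x y := by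
  refine ContinuousOn.intervalIntegrable_of_Icc hxy fun t ht => ?_
  exact ((Real.continuousAt_rpow_const t r (Or.inl (hx.trans_le ht.1).ne')).mul
    (by fun_prop)).continuousWithinAt

lemma integral_exp_neg_eq_sub (x y : ℝ) :
    ∫ t in x..y, Real.exp (-t) = Real.exp (-x) - Real.exp (-y) := by
  rw [intervalIntegral.integral_eq_sub_of_hasDerivAt (f := fun t => -Real.exp (-t))]
  · ring
  · intro t _
    simpa using (hasDerivAt_neg t).exp.fun_neg
  · exact Continuous.intervalIntegrable (by fun_prop) _ _

lemma integral_sub_mul_exp_neg (x y : ℝ) :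
    ∫ t in x..y, (t - x) * Real.exp (-t) = Real.exp (-x) - (y - x + 1) * Real.exp (-y) := by
  rw [intervalIntegral.integral_eq_sub_of_hasDerivAt
    (f := fun t => -((t - x + 1) * Real.exp (-t)))]
  · ring
  · intro t _
    refine ((((hasDerivAt_id' t).sub_const x).add_const 1).fun_mul
      (hasDerivAt_neg t).exp).fun_neg.congr_deriv ?_
    ring
  · exact Continuous.intervalIntegrable (by fun_prop) _ _

lemma rpow_mul_le_integral_rpow_mul_exp_neg {r x y : ℝ} (hr : 0 ≤ r) (hx : 0 < x) (hxy : x ≤ y) :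
    x ^ r * (Real.exp (-x) - Real.exp (-y)) ≤ ∫ t in x..y, t ^ r * Real.exp (-t) := by
  rw [← integral_exp_neg_eq_sub, ← intervalIntegral.integral_const_mul]
  refine intervalIntegral.integral_mono_on hxy
    (Continuous.intervalIntegrable (by fun_prop) _ _)
    (intervalIntegrable_rpow_mul_exp_neg r hx hxy) fun t ht => ?_
  have := Real.rpow_le_rpow hx.le ht.1 hr
  gcongr

lemma mul_integral_le_integral_rpow_add_one {r x y : ℝ} (hx : 0 < x) (hxy : x ≤ y) :
    x * ∫ t in x..y, t ^ r * Real.exp (-t) ≤ ∫ t in x..y, t ^ (r + 1) * Real.exp (-t) := by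
  rw [← intervalIntegral.integral_const_mul]
  refine intervalIntegral.integral_mono_on hxy
    ((intervalIntegrable_rpow_mul_exp_neg r hx hxy).const_mul x)
    (intervalIntegrable_rpow_mul_exp_neg (r + 1) hx hxy) fun t ht => ?_
  have ht0 : 0 < t := hx.trans_le ht.1
  rw [Real.rpow_add_one ht0.ne', mul_comm (t ^ r) t, mul_assoc]
  exact mul_le_mul_of_nonneg_right ht.1 (by positivity)

lemma integral_rpow_add_one_le {r x y : ℝ} (hr : 0 ≤ r) (hx : 0 < x) (hxy : x ≤ y) :
    ∫ t in x..y, t ^ (r + 1) * Real.exp (-t) ≤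
      x * (∫ t in x..y, t ^ r * Real.exp (-t)) + y ^ r * Real.exp (-x) := by
  have hi : IntervalIntegrable (fun t => (t - x) * Real.exp (-t)) volume x y :=
    Continuous.intervalIntegrable (by fun_prop) _ _
  have hD := intervalIntegrable_rpow_mul_exp_neg r hx hxy
  calc ∫ t in x..y, t ^ (r + 1) * Real.exp (-t)
      ≤ ∫ t in x..y, (x * (t ^ r * Real.exp (-t)) + y ^ r * ((t - x) * Real.exp (-t))) := by
        refine intervalIntegral.integral_mono_on hxy
          (intervalIntegrable_rpow_mul_exp_neg (r + 1) hx hxy)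
          ((hD.const_mul x).add (hi.const_mul _)) fun t ht => ?_
        have ht0 : 0 < t := hx.trans_le ht.1
        have h1 : t ^ r * ((t - x) * Real.exp (-t)) ≤ y ^ r * ((t - x) * Real.exp (-t)) :=
          mul_le_mul_of_nonneg_right (Real.rpow_le_rpow ht0.le ht.2 hr)
            (mul_nonneg (sub_nonneg.2 ht.1) (Real.exp_pos _).le)
        rw [Real.rpow_add_one ht0.ne']
        linarith
    _ = x * (∫ t in x..y, t ^ r * Real.exp (-t)) +
          y ^ r * (Real.exp (-x) - (y - x + 1) * Real.exp (-y)) := by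
        rw [intervalIntegral.integral_add (hD.const_mul x) (hi.const_mul _),
          intervalIntegral.integral_const_mul, intervalIntegral.integral_const_mul,
          integral_sub_mul_exp_neg]
    _ ≤ _ := by
        have hy : 0 ≤ y ^ r := Real.rpow_nonneg (hx.le.trans hxy) r
        have : 0 ≤ (y - x + 1) * Real.exp (-y) :=
          mul_nonneg (by linarith) (Real.exp_pos _).le
        gcongr
        linarith

/-- The ECME weighting function `w(δ, θ; d)` tends to `1 − θ` as δ → ∞. -/
theorem weight_tendsto_one_sub_theta (d : ℕ) (hd : 1 ≤ d) (θ : ℝ)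
    (hθ : θ ∈ Set.Ioo (0 : ℝ) 1) :
    Tendsto
      (fun δ : ℝ => 2 * (uGamma ((d : ℝ) / 2 + 2) ((1 - θ) * δ / 2) -
          uGamma ((d : ℝ) / 2 + 2) (δ / 2)) /
        (δ * (uGamma ((d : ℝ) / 2 + 1) ((1 - θ) * δ / 2) -
          uGamma ((d : ℝ) / 2 + 1) (δ / 2))))
      atTop (nhds (1 - θ)) := by
  obtain ⟨h0, h1⟩ := hθ
  have hc : 0 < 1 - θ := sub_pos.2 h1
  have hk : (0 : ℝ) ≤ (d : ℝ) / 2 := by positivity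
  generalize (d : ℝ) / 2 = k at hk ⊢
  have hupper : Tendsto (fun δ : ℝ => (1 - θ) +
      (δ / 2)⁻¹ * (((1 - θ) ^ k)⁻¹ * (1 - Real.exp (-(θ * (δ / 2))))⁻¹)) atTop
      (nhds (1 - θ)) := by
    have hy : Tendsto (fun δ : ℝ => δ / 2) atTop atTop := tendsto_id.atTop_div_const two_pos
    have he : Tendsto (fun δ : ℝ => Real.exp (-(θ * (δ / 2)))) atTop (nhds 0) :=
      Real.tendsto_exp_neg_atTop_nhds_zero.comp (hy.const_mul_atTop h0)
    have := (tendsto_inv_atTop_zero.comp hy).mul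
      (((he.const_sub 1).inv₀ (by norm_num)).const_mul ((1 - θ) ^ k)⁻¹)
    simpa using this.const_add (1 - θ)
  have hbounds : ∀ δ : ℝ, 0 < δ →
      let w := 2 * (uGamma (k + 2) ((1 - θ) * δ / 2) - uGamma (k + 2) (δ / 2)) /
        (δ * (uGamma (k + 1) ((1 - θ) * δ / 2) - uGamma (k + 1) (δ / 2)))
      1 - θ ≤ w ∧ w ≤ (1 - θ) +
        (δ / 2)⁻¹ * (((1 - θ) ^ k)⁻¹ * (1 - Real.exp (-(θ * (δ / 2))))⁻¹) := by
    intro δ hδ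
    obtain ⟨y, rfl⟩ : ∃ y, δ = 2 * y := ⟨δ / 2, by ring⟩
    have hy : 0 < y := by linarith
    have hx : 0 < (1 - θ) * y := mul_pos hc hy
    have hxy : (1 - θ) * y ≤ y := by nlinarith
    have e1 : (1 - θ) * (2 * y) / 2 = (1 - θ) * y := by ring
    have e2 : 2 * y / 2 = y := by ring
    rw [e1, e2, uGamma_sub_uGamma_s16 (by linarith) hx hxy, uGamma_sub_uGamma_s16 (by linarith) hx hxy,
      show k + 2 - 1 = k + 1 by ring, show k + 1 - 1 = k by ring]
    have hlow := mul_integral_le_integral_rpow_add_one (r := k) hx hxy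
    have hup := integral_rpow_add_one_le hk hx hxy
    have hD := rpow_mul_le_integral_rpow_mul_exp_neg hk hx hxy
    set D := ∫ t in (1 - θ) * y..y, t ^ k * Real.exp (-t)
    set N := ∫ t in (1 - θ) * y..y, t ^ (k + 1) * Real.exp (-t)
    have hE : 0 < 1 - Real.exp (-(θ * y)) :=
      sub_pos.2 (Real.exp_lt_one_iff.2 (neg_neg_of_pos (mul_pos h0 hy)))
    have hck : 0 < (1 - θ) ^ k := Real.rpow_pos_of_pos hc k
    have hyk : 0 < y ^ k := Real.rpow_pos_of_pos hy k
    have hexp : Real.exp (-y) = Real.exp (-((1 - θ) * y)) * Real.exp (-(θ * y)) := by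
      rw [← Real.exp_add]
      ring_nf
    have hD' : (1 - θ) ^ k * (1 - Real.exp (-(θ * y))) *
        (y ^ k * Real.exp (-((1 - θ) * y))) ≤ D := by
      refine le_of_eq_of_le ?_ hD
      rw [Real.mul_rpow hc.le hy.le, hexp]
      ring
    have hDpos : 0 < D := lt_of_lt_of_le (by positivity) hD'
    have hw : 2 * N / (2 * y * D) = N / (y * D) := by
      rw [mul_assoc, mul_div_mul_left _ _ two_ne_zero]
    intro w
    simp only [w, hw]
    constructor
    · rw [le_div_iff₀ (by positivity)]
      linarith
    · rw [div_le_iff₀ (by positivity)]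
      have hB : y ^ k * Real.exp (-((1 - θ) * y)) ≤
          ((1 - θ) ^ k)⁻¹ * (1 - Real.exp (-(θ * y)))⁻¹ * D := by
        rw [← mul_inv, inv_mul_eq_div, le_div_iff₀ (by positivity)]
        linarith
      calc N ≤ (1 - θ) * y * D + ((1 - θ) ^ k)⁻¹ * (1 - Real.exp (-(θ * y)))⁻¹ * D := by
            linarith
        _ = _ := by
            field_simp
  refine tendsto_of_tendsto_of_tendsto_of_le_of_le' tendsto_const_nhds hupper ?_ ?_
  · filter_upwards [eventually_gt_atTop 0] with δ hδ using (hbounds δ hδ).1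
  · filter_upwards [eventually_gt_atTop 0] with δ hδ using (hbounds δ hδ).2
end
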